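/- arXiv:2405.16354 — 8 statements merged into one kernel-verified Lean document; each statement's English description precedes it below -/
import Mathlib

section
/- Let d ≥ 1 be an integer, C ≥ 0 a real number, and let λ : ℕ → ℝ be a sequence that is nondecreasing on indices m ≥ 1 and satisfies the Li–Yau-type bound ∑_{m=1}^{n} λ_m ≥ C · n^{1+2/d} for every integer n ≥ 1. Then for all integers k, n with 1 ≤ k ≤ n one has λ_n ≥ C · n^{2/d} + (k/n)·(λ_n − λ_k). -/
/-- **Theorem 1 (abstract form).** If `lam` is nondecreasing on indices `m ≥ 1` and satisfies the
Li–Yau-type bound `∑_{m=1}^{n} lam m ≥ C n^{1+2/d}` for all `n ≥ 1`, then for all `1 ≤ k ≤ n`,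
`lam n ≥ C n^{2/d} + (k/n)(lam n − lam k)`. -/
theorem stmt_0 (d : ℕ) (hd : 1 ≤ d) (C : ℝ) (hC : 0 ≤ C) (lam : ℕ → ℝ)
    (hmono : ∀ m n : ℕ, 1 ≤ m → m ≤ n → lam m ≤ lam n)
    (hLY : ∀ n : ℕ, 1 ≤ n →
      C * (n : ℝ) ^ ((1 : ℝ) + 2 / d) ≤ ∑ m ∈ Finset.Icc 1 n, lam m)
    (k n : ℕ) (hk : 1 ≤ k) (hkn : k ≤ n) :
    C * (n : ℝ) ^ ((2 : ℝ) / d) + ((k : ℝ) / n) * (lam n - lam k) ≤ lam n := by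
  have hn : (0 : ℝ) < n := by exact_mod_cast hk.trans hkn
  have hgap : (k : ℝ) * (lam n - lam k) ≤ n * lam n - ∑ m ∈ Finset.Icc 1 n, lam m :=
    calc (k : ℝ) * (lam n - lam k)
      _ = ∑ _m ∈ Finset.Icc 1 k, (lam n - lam k) := by
          simp [-Finset.sum_sub_distrib]
      _ ≤ ∑ m ∈ Finset.Icc 1 k, (lam n - lam m) := by
        refine Finset.sum_le_sum fun m hm => ?_
        rw [Finset.mem_Icc] at hm
        exact sub_le_sub_left (hmono m k hm.1 hm.2) _
      _ ≤ ∑ m ∈ Finset.Icc 1 n, (lam n - lam m) := by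
        refine Finset.sum_le_sum_of_subset_of_nonneg (Finset.Icc_subset_Icc_right hkn)
          fun m hm _ => ?_
        rw [Finset.mem_Icc] at hm
        exact sub_nonneg.2 (hmono m n hm.1 hm.2)
      _ = n * lam n - ∑ m ∈ Finset.Icc 1 n, lam m := by simp
  have hsum := hLY n (hk.trans hkn)
  rw [Real.rpow_add hn, Real.rpow_one] at hsum
  refine le_of_mul_le_mul_left ?_ hn
  calc (n : ℝ) * (C * (n : ℝ) ^ ((2 : ℝ) / d) + ((k : ℝ) / n) * (lam n - lam k))
      = C * (n * (n : ℝ) ^ ((2 : ℝ) / d)) + k * (lam n - lam k) := by field_simp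
    _ ≤ n * lam n := by linarith
end

section
/- Let d ≥ 1 be an integer, C ≥ 0 a real number, and let λ : ℕ → ℝ be a sequence that is nondecreasing on indices m ≥ 1 and satisfies the Li–Yau-type bound ∑_{m=1}^{n} λ_m ≥ C · n^{1+2/d} for every integer n ≥ 1. Then for all integers k, n with 1 ≤ k ≤ n one has ((n−k)/n)·λ_n + (k/n)·λ_k ≥ C · n^{2/d}. -/
/-- For a sequence that is nondecreasing from index `1` on, splitting the partial sum at `k` and
bounding each block by its last term. -/
theorem sum_Icc_one_le_of_monotone {f : ℕ → ℝ}
    (hf : ∀ m n : ℕ, 1 ≤ m → m ≤ n → f m ≤ f n) {k n : ℕ} (hkn : k ≤ n) :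
    ∑ m ∈ Finset.Icc 1 n, f m ≤ k * f k + ((n : ℝ) - k) * f n := by
  have block (a b : ℕ) (hab : a ≤ b) :
      ∑ m ∈ Finset.Ioc a b, f m ≤ ((b : ℝ) - a) * f b := by
    have h := Finset.sum_le_card_nsmul (Finset.Ioc a b) f (f b) fun m hm => by
      rw [Finset.mem_Ioc] at hm
      exact hf m b (by omega) hm.2
    rwa [Nat.card_Ioc, nsmul_eq_mul, Nat.cast_sub hab] at h
  have hsplit : ∑ m ∈ Finset.Icc 1 n, f m =
      ∑ m ∈ Finset.Ioc 0 k, f m + ∑ m ∈ Finset.Ioc k n, f m :=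
    (Finset.sum_Ioc_consecutive f k.zero_le hkn).symm
  have h₀ := block 0 k k.zero_le
  rw [Nat.cast_zero, sub_zero] at h₀
  rw [hsplit]
  exact add_le_add h₀ (block k n hkn)

/-- Key rearranged inequality in the proof of Theorem 1: under the Li–Yau-type bound,
`((n−k)/n)·lam n + (k/n)·lam k ≥ C n^{2/d}` for all `1 ≤ k ≤ n`. -/
theorem stmt_1 (d : ℕ) (hd : 1 ≤ d) (C : ℝ) (hC : 0 ≤ C) (lam : ℕ → ℝ)
    (hmono : ∀ m n : ℕ, 1 ≤ m → m ≤ n → lam m ≤ lam n)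
    (hLY : ∀ n : ℕ, 1 ≤ n →
      C * (n : ℝ) ^ ((1 : ℝ) + 2 / d) ≤ ∑ m ∈ Finset.Icc 1 n, lam m)
    (k n : ℕ) (hk : 1 ≤ k) (hkn : k ≤ n) :
    C * (n : ℝ) ^ ((2 : ℝ) / d) ≤
      (((n : ℝ) - k) / n) * lam n + ((k : ℝ) / n) * lam k := by
  have hn : (0 : ℝ) < n := by exact_mod_cast hk.trans hkn
  have hsum := (hLY n (hk.trans hkn)).trans (sum_Icc_one_le_of_monotone hmono hkn)
  rw [Real.rpow_add hn, Real.rpow_one] at hsum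
  have hrhs : (((n : ℝ) - k) / n) * lam n + ((k : ℝ) / n) * lam k =
      (k * lam k + ((n : ℝ) - k) * lam n) / n := by ring
  rw [hrhs, le_div_iff₀ hn]
  linarith
end

section
/- Let C ≥ 0 be a real number and let λ : ℕ → ℝ be a sequence that is nondecreasing on indices m ≥ 1 and satisfies ∑_{m=1}^{n} λ_m ≥ C · n² for every integer n ≥ 1. Then for every integer n ≥ 1 one has 2·λ_n + λ_{2n} ≥ 5·C·n, equivalently λ_n/n + λ_{2n}/(2n) ≥ (5/2)·C. -/
/-- **Corollary (special case d = 2, abstract form).** If `lam` is nondecreasing on indices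
`m ≥ 1` and `∑_{m=1}^{n} lam m ≥ C n²` for all `n ≥ 1`, then
`2·lam n + lam (2n) ≥ 5·C·n` for every `n ≥ 1`. -/
theorem stmt_2 (C : ℝ) (hC : 0 ≤ C) (lam : ℕ → ℝ)
    (hmono : ∀ m n : ℕ, 1 ≤ m → m ≤ n → lam m ≤ lam n)
    (hLY : ∀ n : ℕ, 1 ≤ n → C * (n : ℝ) ^ 2 ≤ ∑ m ∈ Finset.Icc 1 n, lam m)
    (n : ℕ) (hn : 1 ≤ n) :
    5 * C * n ≤ 2 * lam n + lam (2 * n) := by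
  have hfirst : ∑ m ∈ Finset.Icc 1 n, lam m ≤ n * lam n := by
    have h := Finset.sum_le_card_nsmul (Finset.Icc 1 n) lam (lam n) fun m hm =>
      hmono m n (Finset.mem_Icc.1 hm).1 (Finset.mem_Icc.1 hm).2
    simpa using h
  have hsecond : ∑ m ∈ Finset.Ioc n (2 * n), lam m ≤ n * lam (2 * n) := by
    have h := Finset.sum_le_card_nsmul (Finset.Ioc n (2 * n)) lam (lam (2 * n)) fun m hm =>
      hmono m (2 * n) (hn.trans (Finset.mem_Ioc.1 hm).1.le) (Finset.mem_Ioc.1 hm).2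
    simpa [two_mul] using h
  have hsplit : ∑ m ∈ Finset.Icc 1 (2 * n), lam m =
      ∑ m ∈ Finset.Icc 1 n, lam m + ∑ m ∈ Finset.Ioc n (2 * n), lam m := by
    have hIcc (k : ℕ) : Finset.Icc 1 k = Finset.Ioc 0 k := by
      ext m
      simp only [Finset.mem_Icc, Finset.mem_Ioc]
      lia
    rw [hIcc, hIcc]
    exact (Finset.sum_Ioc_consecutive lam (Nat.zero_le n) (Nat.le_mul_of_pos_left n two_pos)).symm
  have h₁ := hLY n hn
  have h₂ := hLY (2 * n) (by lia)
  push_cast at h₂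
  have hpos : (0 : ℝ) < n := by exact_mod_cast hn
  refine le_of_mul_le_mul_left ?_ hpos
  linarith
end

section
/- Let d ≥ 1 be an integer, C ≥ 0 a real number, and let λ : ℕ → ℝ be a sequence that is nondecreasing on indices m ≥ 1 and satisfies the Li–Yau-type bound ∑_{m=1}^{k} λ_m ≥ C · k^{1+2/d} for every integer k ≥ 1. If the integers n, ℓ ≥ 1 satisfy (n+ℓ)^{2/d} · ℓ ≥ n^{1+2/d}, then λ_n/n^{2/d} + λ_{n+ℓ}/(n+ℓ)^{2/d} ≥ (2 + (n/ℓ)·(1 − (n/(n+ℓ))^{2/d}))·C. -/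
/-- The sum of the first `n + ℓ` terms of a nondecreasing sequence is bounded by its values at
the indices `n` and `n + ℓ`. -/
lemma sum_Icc_one_add_le_of_mono {f : ℕ → ℝ} (hf : ∀ m n : ℕ, 1 ≤ m → m ≤ n → f m ≤ f n)
    (n ℓ : ℕ) : ∑ m ∈ Finset.Icc 1 (n + ℓ), f m ≤ n * f n + ℓ * f (n + ℓ) := by
  have hbase : ∑ m ∈ Finset.Icc 1 n, f m ≤ n * f n := by
    have h := Finset.sum_le_card_nsmul (Finset.Icc 1 n) f (f n) fun m hm =>
      hf m n (Finset.mem_Icc.mp hm).1 (Finset.mem_Icc.mp hm).2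
    simpa using h
  induction ℓ with
  | zero => simpa using hbase
  | succ k ih =>
    rw [← add_assoc, Finset.sum_Icc_succ_top (by omega)]
    have hstep : (k : ℝ) * f (n + k) ≤ k * f (n + k + 1) := by
      rcases Nat.eq_zero_or_pos k with rfl | hk
      · simp
      · exact mul_le_mul_of_nonneg_left (hf _ _ (by omega) (by omega)) k.cast_nonneg
    push_cast
    linarith

/-- **Theorem 2 (abstract form).** Under the Li–Yau-type bound, if `(n+ℓ)^{2/d} ℓ ≥ n^{1+2/d}`,
then `lam n / n^{2/d} + lam (n+ℓ) / (n+ℓ)^{2/d} ≥ (2 + (n/ℓ)(1 − (n/(n+ℓ))^{2/d}))·C`. -/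
theorem stmt_3 (d : ℕ) (hd : 1 ≤ d) (C : ℝ) (hC : 0 ≤ C) (lam : ℕ → ℝ)
    (hmono : ∀ m n : ℕ, 1 ≤ m → m ≤ n → lam m ≤ lam n)
    (hLY : ∀ k : ℕ, 1 ≤ k →
      C * (k : ℝ) ^ ((1 : ℝ) + 2 / d) ≤ ∑ m ∈ Finset.Icc 1 k, lam m)
    (n ℓ : ℕ) (hn : 1 ≤ n) (hℓ : 1 ≤ ℓ)
    (hcond : (n : ℝ) ^ ((1 : ℝ) + 2 / d) ≤ ((n : ℝ) + ℓ) ^ ((2 : ℝ) / d) * ℓ) :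
    (2 + ((n : ℝ) / ℓ) * (1 - ((n : ℝ) / ((n : ℝ) + ℓ)) ^ ((2 : ℝ) / d))) * C ≤
      lam n / (n : ℝ) ^ ((2 : ℝ) / d) + lam (n + ℓ) / ((n : ℝ) + ℓ) ^ ((2 : ℝ) / d) := by
  have hn0 : (0 : ℝ) < n := by exact_mod_cast hn
  have hℓ0 : (0 : ℝ) < ℓ := by exact_mod_cast hℓ
  have hx := (hLY n hn).trans (sum_Icc_one_add_le_of_mono hmono n 0)
  have hy := (hLY (n + ℓ) (by omega)).trans (sum_Icc_one_add_le_of_mono hmono n ℓ)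
  push_cast at hx hy
  rw [Real.rpow_add hn0, Real.rpow_one] at hx hcond
  rw [Real.rpow_add (by positivity), Real.rpow_one] at hy
  rw [Real.div_rpow hn0.le (by positivity)]
  have ha : 0 < (n : ℝ) ^ ((2 : ℝ) / d) := by positivity
  have hb : 0 < ((n : ℝ) + ℓ) ^ ((2 : ℝ) / d) := by positivity
  generalize (n : ℝ) ^ ((2 : ℝ) / d) = a at *
  generalize ((n : ℝ) + ℓ) ^ ((2 : ℝ) / d) = b at *
  have hx' : C * a ≤ lam n := le_of_mul_le_mul_left (by linarith) hn0
  have h₁ : 0 ≤ (lam n - C * a) * (ℓ * b - n * a) / (a * ℓ * b) :=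
    div_nonneg (mul_nonneg (by linarith) (by linarith)) (by positivity)
  have h₂ : 0 ≤ (n * lam n + ℓ * lam (n + ℓ) - C * ((n + ℓ) * b)) / (ℓ * b) :=
    div_nonneg (by linarith) (by positivity)
  rw [← sub_nonneg]
  refine (add_nonneg h₁ h₂).trans_eq ?_
  field_simp
  ring
end

section
/- Let d ≥ 1 be an integer, C ≥ 0 a real number, and let λ : ℕ → ℝ be a sequence that is nondecreasing on indices m ≥ 1 and satisfies the Li–Yau-type bound ∑_{m=1}^{k} λ_m ≥ C · k^{1+2/d} for every integer k ≥ 1. Then for every integer n ≥ 1 one has λ_n/n^{2/d} + λ_{2n}/(2n)^{2/d} ≥ (3 − 2^{−2/d})·C. -/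
theorem sum_Ioc_le_mul_of_monotone {f : ℕ → ℝ}
    (hf : ∀ m n : ℕ, 1 ≤ m → m ≤ n → f m ≤ f n) {j k : ℕ} (hjk : j ≤ k) :
    ∑ m ∈ Finset.Ioc j k, f m ≤ ((k : ℝ) - j) * f k := by
  have h := Finset.sum_le_card_nsmul (Finset.Ioc j k) f (f k) fun m hm => by
    rw [Finset.mem_Ioc] at hm
    exact hf m k (by lia) hm.2
  rwa [Nat.card_Ioc, nsmul_eq_mul, Nat.cast_sub hjk] at h

/-- Special case `ℓ = n` of Theorem 2: under the Li–Yau-type bound,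
`lam n / n^{2/d} + lam (2n) / (2n)^{2/d} ≥ (3 − 2^{−2/d})·C` for every `n ≥ 1`. -/
theorem stmt_4 (d : ℕ) (hd : 1 ≤ d) (C : ℝ) (hC : 0 ≤ C) (lam : ℕ → ℝ)
    (hmono : ∀ m n : ℕ, 1 ≤ m → m ≤ n → lam m ≤ lam n)
    (hLY : ∀ k : ℕ, 1 ≤ k →
      C * (k : ℝ) ^ ((1 : ℝ) + 2 / d) ≤ ∑ m ∈ Finset.Icc 1 k, lam m)
    (n : ℕ) (hn : 1 ≤ n) :
    (3 - (2 : ℝ) ^ (-(2 / (d : ℝ)))) * C ≤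
      lam n / (n : ℝ) ^ ((2 : ℝ) / d) + lam (2 * n) / ((2 * n : ℕ) : ℝ) ^ ((2 : ℝ) / d) := by
  have hIcc (k : ℕ) : Finset.Icc 1 k = Finset.Ioc 0 k := Finset.Icc_add_one_left_eq_Ioc 0 k
  simp only [hIcc] at hLY
  have hn₀ : (0 : ℝ) < n := by exact_mod_cast hn
  have hfirst := hLY n hn
  have hdouble := hLY (2 * n) (by lia)
  have hsum : ∑ m ∈ Finset.Ioc 0 n, lam m ≤ n * lam n := by
    simpa using sum_Ioc_le_mul_of_monotone hmono (Nat.zero_le n)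
  have hsum_double : ∑ m ∈ Finset.Ioc 0 (2 * n), lam m ≤ n * lam n + n * lam (2 * n) := by
    have hupper := sum_Ioc_le_mul_of_monotone hmono (show n ≤ 2 * n by lia)
    have hsplit : ∑ m ∈ Finset.Ioc 0 n, lam m + ∑ m ∈ Finset.Ioc n (2 * n), lam m
        = ∑ m ∈ Finset.Ioc 0 (2 * n), lam m :=
      Finset.sum_Ioc_consecutive lam (Nat.zero_le n) (by lia)
    push_cast at hupper
    linarith
  push_cast at hdouble ⊢
  rw [Real.rpow_add hn₀, Real.rpow_one] at hfirst
  rw [Real.rpow_add (by positivity), Real.rpow_one,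
    Real.mul_rpow (by norm_num) hn₀.le] at hdouble
  rw [Real.mul_rpow (by norm_num) hn₀.le, Real.rpow_neg (by norm_num)]
  have ht : (1 : ℝ) ≤ 2 ^ ((2 : ℝ) / d) := Real.one_le_rpow (by norm_num) (by positivity)
  have hN : (0 : ℝ) < (n : ℝ) ^ ((2 : ℝ) / d) := Real.rpow_pos_of_pos hn₀ _
  generalize (2 : ℝ) ^ ((2 : ℝ) / d) = t at *
  generalize (n : ℝ) ^ ((2 : ℝ) / d) = N at *
  have ha : C * N ≤ lam n := le_of_mul_le_mul_left (by linarith) hn₀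
  have hab : 2 * C * (t * N) ≤ lam n + lam (2 * n) :=
    le_of_mul_le_mul_left (by linarith) hn₀
  have ht₀ : 0 < t := by linarith
  have hcombined : (3 * t - 1) * C * N ≤ t * lam n + lam (2 * n) := by
    linarith [mul_le_mul_of_nonneg_left ha (sub_nonneg.2 ht)]
  calc (3 - t⁻¹) * C = (3 * t - 1) * C * N / (t * N) := by field_simp
    _ ≤ (t * lam n + lam (2 * n)) / (t * N) := by gcongr
    _ = lam n / N + lam (2 * n) / (t * N) := by field_simp
end

section
/- For every integer d ≥ 1 there exists a constant c > 0, depending only on d, with the following property: whenever C ≥ 0 is a real number and λ : ℕ → ℝ is a sequence that is nondecreasing on indices m ≥ 1, satisfies ∑_{m=1}^{k} λ_m ≥ C · k^{1+2/d} for every integer k ≥ 1, and satisfies λ_1 ≥ 2.8·C, then for every integer n ≥ 1 one has (1/n)·∑_{m=1}^{n} λ_m/m^{2/d} ≥ (1+c)·C. -/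
/-- One step of `x ↦ x ^ (-a)` from `n` to `n + 1`, weighted by `n ^ (1 + a)`, is bounded below
uniformly in `n`. -/
lemma min_one_div_two_le_rpow_mul_sub {a : ℝ} (ha : 0 < a) {n : ℕ} (hn : 1 ≤ n) :
    min a 1 / 2 ≤ (n : ℝ) ^ (1 + a) * (1 / (n : ℝ) ^ a - 1 / ((n : ℝ) + 1) ^ a) := by
  have hn1 : (1 : ℝ) ≤ n := by exact_mod_cast hn
  have hn0 : (0 : ℝ) < n := by linarith
  set b := min a 1
  have hb : 0 < b := lt_min ha one_pos
  have bernoulli : ((n : ℝ) / (n + 1)) ^ a ≤ 1 - b / (n + 1) := by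
    calc ((n : ℝ) / (n + 1)) ^ a ≤ ((n : ℝ) / (n + 1)) ^ b :=
          Real.rpow_le_rpow_of_exponent_ge (by positivity)
            ((div_le_one (by linarith)).2 (by linarith)) (min_le_left a 1)
      _ = (1 + -(1 / ((n : ℝ) + 1))) ^ b := by congr 1; field_simp; ring
      _ ≤ 1 + b * -(1 / ((n : ℝ) + 1)) := by
          refine rpow_one_add_le_one_add_mul_self ?_ hb.le (min_le_right a 1)
          rw [neg_le_neg_iff, div_le_one (by linarith)]
          linarith
      _ = 1 - b / (n + 1) := by ring
  have factor : (n : ℝ) ^ (1 + a) * (1 / (n : ℝ) ^ a - 1 / ((n : ℝ) + 1) ^ a)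
      = n * (1 - ((n : ℝ) / (n + 1)) ^ a) := by
    rw [Real.rpow_add hn0, Real.rpow_one, Real.div_rpow hn0.le (by positivity)]
    have := (Real.rpow_pos_of_pos hn0 a).ne'
    field_simp
  have half : 1 / 2 ≤ (n : ℝ) / (n + 1) := by
    rw [div_le_div_iff₀ two_pos (by linarith)]
    linarith
  calc b / 2 = b * (1 / 2) := by ring
    _ ≤ b * (n / (n + 1)) := by gcongr
    _ = n * (1 - (1 - b / (n + 1))) := by ring
    _ ≤ n * (1 - ((n : ℝ) / (n + 1)) ^ a) := by gcongr
    _ = _ := factor.symm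

/-- Abel summation: lower bounds `C k ^ (1 + a)` on the partial sums of `u` bound the partial sums
of `u m / m ^ a` from below, with a linear gain. -/
lemma sum_div_rpow_ge {a C : ℝ} (ha : 0 < a) (hC : 0 ≤ C) {u : ℕ → ℝ}
    (hu : ∀ k : ℕ, 1 ≤ k → C * (k : ℝ) ^ (1 + a) ≤ ∑ m ∈ Finset.Icc 1 k, u m)
    {n : ℕ} (hn : 1 ≤ n) :
    (∑ m ∈ Finset.Icc 1 n, u m) / (n : ℝ) ^ a + C * (min a 1 / 2) * ((n : ℝ) - 1) ≤
      ∑ m ∈ Finset.Icc 1 n, u m / (m : ℝ) ^ a := by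
  induction n, hn using Nat.le_induction with
  | base => simp
  | succ n hn ih =>
    rw [Finset.sum_Icc_succ_top (by omega), Finset.sum_Icc_succ_top (by omega)]
    push_cast
    have hn0 : (0 : ℝ) < n := by exact_mod_cast hn
    have step_nonneg : 0 ≤ 1 / (n : ℝ) ^ a - 1 / ((n : ℝ) + 1) ^ a := by
      rw [sub_nonneg]
      gcongr
      linarith
    have gain := (mul_le_mul_of_nonneg_left (min_one_div_two_le_rpow_mul_sub ha hn) hC).trans
      ((mul_assoc _ _ _).symm.trans_le (mul_le_mul_of_nonneg_right (hu n hn) step_nonneg))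
    rw [mul_sub, mul_one_div, mul_one_div] at gain
    rw [add_div]
    linarith

/-- **Theorem 3 (abstract form).** For every `d ≥ 1` there is `c > 0` depending only on `d` such
that for every `C ≥ 0` and every sequence `lam` nondecreasing on indices `m ≥ 1` with
`∑_{m=1}^{k} lam m ≥ C k^{1+2/d}` for all `k ≥ 1` and `lam 1 ≥ 2.8·C`, one has
`(1/n)·∑_{m=1}^{n} lam m / m^{2/d} ≥ (1+c)·C` for every `n ≥ 1`. -/
theorem stmt_6 (d : ℕ) (hd : 1 ≤ d) :
    ∃ c : ℝ, 0 < c ∧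
      ∀ (C : ℝ), 0 ≤ C → ∀ (lam : ℕ → ℝ),
        (∀ m n : ℕ, 1 ≤ m → m ≤ n → lam m ≤ lam n) →
        (∀ k : ℕ, 1 ≤ k →
          C * (k : ℝ) ^ ((1 : ℝ) + 2 / d) ≤ ∑ m ∈ Finset.Icc 1 k, lam m) →
        2.8 * C ≤ lam 1 →
        ∀ n : ℕ, 1 ≤ n →
          (1 + c) * C ≤ (1 / n) * ∑ m ∈ Finset.Icc 1 n, lam m / (m : ℝ) ^ ((2 : ℝ) / d) := by
  have ha : (0 : ℝ) < 2 / d := by positivity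
  have hb : 0 < min ((2 : ℝ) / d) 1 := lt_min ha one_pos
  have hb1 : min ((2 : ℝ) / d) 1 ≤ 1 := min_le_right _ _
  refine ⟨min ((2 : ℝ) / d) 1 / 4, by positivity, fun C hC lam _ hsum h1 n hn => ?_⟩
  obtain rfl | hn2 := hn.eq_or_lt
  · norm_num at h1 ⊢
    nlinarith
  have hn2' : (2 : ℝ) ≤ n := by exact_mod_cast hn2
  have hn0 : (0 : ℝ) < n := by linarith
  have abel := sum_div_rpow_ge ha hC hsum hn
  have top : C * n ≤ (∑ m ∈ Finset.Icc 1 n, lam m) / (n : ℝ) ^ ((2 : ℝ) / d) := by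
    rw [le_div_iff₀ (by positivity), mul_assoc]
    simpa [Real.rpow_add hn0] using hsum n hn
  rw [one_div_mul_eq_div, le_div_iff₀ hn0]
  have : 0 ≤ C * min ((2 : ℝ) / d) 1 * ((n : ℝ) - 2) :=
    mul_nonneg (by positivity) (by linarith)
  linarith
end

section
/- Let d ≥ 1 be an integer, C ≥ 0 a real number, and let λ : ℕ → ℝ be a sequence that is nondecreasing on indices m ≥ 1, satisfies ∑_{m=1}^{k} λ_m ≥ C · k^{1+2/d} for every integer k ≥ 1, and satisfies λ_1 ≥ 2.8·C. Then for every integer n ≥ 1 one has (1/n)·∑_{m=1}^{n} λ_m/m^{2/d} ≥ (1 + 1/n)·C. -/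
/-- Bounding every weight `m ^ (-a)` below by `n ^ (-a)`, except the first one, in a weighted sum
of nonnegative terms. -/
theorem first_add_inv_rpow_mul_sum_le_sum_div_rpow {lam : ℕ → ℝ} {a : ℝ} (n : ℕ) (hn : 1 ≤ n) (ha : 0 ≤ a)
    (hlam : ∀ m ∈ Finset.Icc 1 n, 0 ≤ lam m) :
    lam 1 * (1 - ((n : ℝ) ^ a)⁻¹) + ((n : ℝ) ^ a)⁻¹ * ∑ m ∈ Finset.Icc 1 n, lam m ≤
      ∑ m ∈ Finset.Icc 1 n, lam m / (m : ℝ) ^ a := by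
  have htail : ((n : ℝ) ^ a)⁻¹ * ∑ m ∈ Finset.Ioc 1 n, lam m ≤
      ∑ m ∈ Finset.Ioc 1 n, lam m / (m : ℝ) ^ a := by
    rw [Finset.mul_sum]
    refine Finset.sum_le_sum fun m hm => ?_
    obtain ⟨h1, h2⟩ := Finset.mem_Ioc.1 hm
    have hm0 : (0 : ℝ) < m := by exact_mod_cast zero_lt_one.trans h1
    have hlm := hlam m (Finset.mem_Icc.2 ⟨h1.le, h2⟩)
    rw [div_eq_inv_mul]
    gcongr
  rw [← Finset.Ioc_insert_left hn, Finset.sum_insert (by simp), Finset.sum_insert (by simp)]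
  simp only [Nat.cast_one, Real.one_rpow, div_one]
  linarith


/-- **Lemma 2 (abstract form).** If `lam` is nondecreasing on indices `m ≥ 1`, satisfies the
Li–Yau-type bound, and `lam 1 ≥ 2.8·C`, then
`(1/n)·∑_{m=1}^{n} lam m / m^{2/d} ≥ (1 + 1/n)·C` for every `n ≥ 1`. -/
theorem stmt_7 (d : ℕ) (hd : 1 ≤ d) (C : ℝ) (hC : 0 ≤ C) (lam : ℕ → ℝ)
    (hmono : ∀ m n : ℕ, 1 ≤ m → m ≤ n → lam m ≤ lam n)
    (hLY : ∀ k : ℕ, 1 ≤ k →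
      C * (k : ℝ) ^ ((1 : ℝ) + 2 / d) ≤ ∑ m ∈ Finset.Icc 1 k, lam m)
    (hFK : 2.8 * C ≤ lam 1)
    (n : ℕ) (hn : 1 ≤ n) :
    (1 + 1 / (n : ℝ)) * C ≤ (1 / n) * ∑ m ∈ Finset.Icc 1 n, lam m / (m : ℝ) ^ ((2 : ℝ) / d) := by
  have hn' : (1 : ℝ) ≤ n := by exact_mod_cast hn
  have hn0 : (0 : ℝ) < n := by linarith
  have ha : (0 : ℝ) ≤ 2 / d := by positivity
  have hlam_lower : ∀ m ∈ Finset.Icc 1 n, 2.8 * C ≤ lam m := fun m hm =>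
    hFK.trans (hmono 1 m le_rfl (Finset.mem_Icc.1 hm).1)
  have hsum := first_add_inv_rpow_mul_sum_le_sum_div_rpow n hn ha (lam := lam) fun m hm =>
    le_trans (by positivity) (hlam_lower m hm)
  have hlin : n * (2.8 * C) ≤ ∑ m ∈ Finset.Icc 1 n, lam m := by
    simpa using Finset.card_nsmul_le_sum (Finset.Icc 1 n) lam _ hlam_lower
  have hLYn := hLY n hn
  rw [Real.rpow_add hn0, Real.rpow_one] at hLYn
  have hy : 1 ≤ (n : ℝ) ^ ((2 : ℝ) / d) := Real.one_le_rpow hn' ha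
  set y := (n : ℝ) ^ ((2 : ℝ) / d)
  set S := ∑ m ∈ Finset.Icc 1 n, lam m
  have hx0 : 0 < y⁻¹ := by positivity
  have hx1 : y⁻¹ ≤ 1 := inv_le_one_of_one_le₀ hy
  have hSLY : n * C ≤ y⁻¹ * S := by
    calc n * C = y⁻¹ * (C * (n * y)) := by field_simp
      _ ≤ y⁻¹ * S := by gcongr
  have hSlin : y⁻¹ * (n * (2.8 * C)) ≤ y⁻¹ * S := by gcongr
  have hfirst : 2.8 * C * (1 - y⁻¹) ≤ lam 1 * (1 - y⁻¹) :=
    mul_le_mul_of_nonneg_right hFK (by linarith)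
  have key : (n + 1) * C ≤ ∑ m ∈ Finset.Icc 1 n, lam m / (m : ℝ) ^ ((2 : ℝ) / d) := by
    refine le_trans ?_ hsum
    rcases le_total y⁻¹ (9 / 14) with h | h
    · nlinarith [mul_le_mul_of_nonneg_left h hC]
    · have hnC : 0 ≤ ((n : ℝ) - 1) * C := mul_nonneg (by linarith) hC
      nlinarith [mul_le_mul_of_nonneg_left h hnC]
  calc (1 + 1 / (n : ℝ)) * C = (1 / n) * ((n + 1) * C) := by field_simp
    _ ≤ _ := by gcongr
end

section
/- For every integer d ≥ 1 there exist a real number ε₁ > 0 and an integer n₀, both depending only on d, with the following property: whenever C > 0 is a real number and λ : ℕ → ℝ is a sequence that is nondecreasing on indices m ≥ 1 and satisfies ∑_{m=1}^{k} λ_m ≥ C · k^{1+2/d} for every integer k ≥ 1, then for every integer n ≥ n₀ one has (1/n)·∑_{m=1}^{n} λ_m/m^{2/d} ≥ (1 + ε₁)·C. -/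
/-- A lower bound, uniform in `k`, for the weights produced by summation by parts against
`k ↦ 1 / k ^ s`. -/
theorem half_le_rpow_mul_inv_rpow_sub {r s : ℝ} (hr : 0 ≤ r) (hr1 : r ≤ 1) (hrs : r ≤ s)
    {k : ℕ} (hk : 1 ≤ k) :
    r / 2 ≤ (k : ℝ) ^ (1 + s) * (((k : ℝ) ^ s)⁻¹ - (((k + 1 : ℕ) : ℝ) ^ s)⁻¹) := by
  have hk' : (1 : ℝ) ≤ k := by exact_mod_cast hk
  have hk0 : (0 : ℝ) < k := by linarith
  have hk1 : (0 : ℝ) < (k : ℝ) + 1 := by linarith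
  have hbern : ((k : ℝ) / (k + 1)) ^ s ≤ 1 - r / (k + 1) := by
    have hx1 : (k : ℝ) / (k + 1) ≤ 1 := by rw [div_le_one hk1]; linarith
    calc ((k : ℝ) / (k + 1)) ^ s ≤ ((k : ℝ) / (k + 1)) ^ r :=
          Real.rpow_le_rpow_of_exponent_ge (by positivity) hx1 hrs
      _ = (1 + -(1 / ((k : ℝ) + 1))) ^ r := by congr 1; field_simp; ring
      _ ≤ 1 + r * -(1 / ((k : ℝ) + 1)) := by
          refine rpow_one_add_le_one_add_mul_self ?_ hr hr1
          rw [neg_le_neg_iff, div_le_one hk1]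
          linarith
      _ = 1 - r / (k + 1) := by ring
  have heq : (k : ℝ) ^ (1 + s) * (((k : ℝ) ^ s)⁻¹ - (((k + 1 : ℕ) : ℝ) ^ s)⁻¹) =
      k * (1 - ((k : ℝ) / (k + 1)) ^ s) := by
    have hks : (k : ℝ) ^ s ≠ 0 := (Real.rpow_pos_of_pos hk0 s).ne'
    push_cast
    rw [Real.rpow_add hk0, Real.rpow_one, Real.div_rpow hk0.le hk1.le]
    field_simp
  rw [heq]
  calc r / 2 ≤ k * (r / (k + 1)) := by
        rw [← mul_div_assoc, div_le_div_iff₀ two_pos hk1]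
        nlinarith
    _ ≤ k * (1 - ((k : ℝ) / (k + 1)) ^ s) := by gcongr; linarith

/-- If the partial sums of `a` dominate `C * k ^ (1 + s)`, then the sum of the quotients
`a m / m ^ s` exceeds its last partial-summation term by an amount linear in `n`. -/
theorem sum_div_rpow_ge_of_sum_ge {r s C : ℝ} (hr : 0 ≤ r) (hr1 : r ≤ 1) (hrs : r ≤ s)
    (hC : 0 ≤ C) {a : ℕ → ℝ}
    (ha : ∀ k : ℕ, 1 ≤ k → C * (k : ℝ) ^ (1 + s) ≤ ∑ m ∈ Finset.Icc 1 k, a m)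
    {n : ℕ} (hn : 1 ≤ n) :
    (∑ m ∈ Finset.Icc 1 n, a m) * ((n : ℝ) ^ s)⁻¹ + C * ((n - 1) * (r / 2)) ≤
      ∑ m ∈ Finset.Icc 1 n, a m / (m : ℝ) ^ s := by
  induction n, hn using Nat.le_induction with
  | base => simp
  | succ k hk ih =>
    rw [Finset.sum_Icc_succ_top (by omega), Finset.sum_Icc_succ_top (by omega),
      div_eq_mul_inv (a (k + 1))]
    have hweight := half_le_rpow_mul_inv_rpow_sub hr hr1 hrs hk
    have hk0 : (0 : ℝ) < k := by exact_mod_cast hk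
    have hdiff : 0 ≤ ((k : ℝ) ^ s)⁻¹ - (((k + 1 : ℕ) : ℝ) ^ s)⁻¹ := by
      refine sub_nonneg.mpr (inv_anti₀ (Real.rpow_pos_of_pos hk0 s) ?_)
      exact Real.rpow_le_rpow hk0.le (by push_cast; linarith) (hr.trans hrs)
    have hstep := mul_le_mul_of_nonneg_right (ha k hk) hdiff
    have hgain := mul_le_mul_of_nonneg_left hweight hC
    have hcast : ((k + 1 : ℕ) : ℝ) - 1 = (k - 1) + 1 := by push_cast; ring
    rw [hcast]
    linarith

/-- Large-`n` part of the proof of Theorem 3: for every `d ≥ 1` there exist `ε₁ > 0` and `n₀`,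
depending only on `d`, such that for every `C > 0` and every sequence `lam` nondecreasing on
indices `m ≥ 1` with `∑_{m=1}^{k} lam m ≥ C k^{1+2/d}` for all `k ≥ 1`, one has
`(1/n)·∑_{m=1}^{n} lam m / m^{2/d} ≥ (1+ε₁)·C` for every `n ≥ n₀`. -/
theorem stmt_17 (d : ℕ) (hd : 1 ≤ d) :
    ∃ ε₁ : ℝ, 0 < ε₁ ∧ ∃ n₀ : ℕ,
      ∀ (C : ℝ), 0 < C → ∀ (lam : ℕ → ℝ),
        (∀ m n : ℕ, 1 ≤ m → m ≤ n → lam m ≤ lam n) →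
        (∀ k : ℕ, 1 ≤ k →
          C * (k : ℝ) ^ ((1 : ℝ) + 2 / d) ≤ ∑ m ∈ Finset.Icc 1 k, lam m) →
        ∀ n : ℕ, n₀ ≤ n →
          (1 + ε₁) * C ≤ (1 / n) * ∑ m ∈ Finset.Icc 1 n, lam m / (m : ℝ) ^ ((2 : ℝ) / d) := by
  have hd' : (1 : ℝ) ≤ d := by exact_mod_cast hd
  have hd0 : (0 : ℝ) < d := by linarith
  refine ⟨1 / d / 4, by positivity, 2, fun C hC lam _ hsum n hn => ?_⟩
  have hn' : (2 : ℝ) ≤ n := by exact_mod_cast hn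
  have hn0 : (0 : ℝ) < n := by linarith
  have hr : 0 ≤ 1 / (d : ℝ) := by positivity
  have hr1 : 1 / (d : ℝ) ≤ 1 := by rwa [div_le_one hd0]
  have hrs : 1 / (d : ℝ) ≤ 2 / d := by gcongr; norm_num
  have hparts := sum_div_rpow_ge_of_sum_ge hr hr1 hrs hC.le hsum (n := n) (by omega)
  have hpow : 0 < (n : ℝ) ^ ((2 : ℝ) / d) := Real.rpow_pos_of_pos hn0 _
  have hlast : C * n ≤ (∑ m ∈ Finset.Icc 1 n, lam m) * ((n : ℝ) ^ ((2 : ℝ) / d))⁻¹ := by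
    rw [← div_eq_mul_inv, le_div_iff₀ hpow, mul_assoc]
    have h := hsum n (by omega)
    rwa [Real.rpow_add hn0, Real.rpow_one] at h
  have hgain : C * (n * (1 / d / 4)) ≤ C * (((n : ℝ) - 1) * (1 / d / 2)) := by
    refine mul_le_mul_of_nonneg_left ?_ hC.le
    nlinarith
  rw [one_div_mul_eq_div, le_div_iff₀ hn0]
  linarith
end
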